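/- Let n_b > n_r > 1, let d₀ > 0, and set C_r = (n_r − 1) d₀ and C_b = (n_b − 1) d₀. Let e, ν be unit vectors in ℝ³ and for n ∈ {n_r, n_b} set m_n = (1/n)(e − Φ_n(e·ν) ν), d_n = C_n/(n − m_n·e). Then there is a constant C' depending only on d₀, n_r, n_b (and not on ν) such that |d_r − d_b| ≤ C' |n_r − n_b|. -/

import Mathlib

/-!
STATEMENT 6: estimate for the difference of the travel distances
`d_n = C_n/(n - m_n·e)`, `C_n = (n-1)d₀`, by the difference of the
refractive indices, with a constant independent of the normal `ν`.
-/

noncomputable section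
open scoped RealInnerProductSpace

abbrev E3 := EuclideanSpace ℝ (Fin 3)

/-- `Φ_κ(s) = s - √(κ² - 1 + s²)`. -/
def Phi (κ s : ℝ) : ℝ := s - Real.sqrt (κ ^ 2 - 1 + s ^ 2)

/-- Refracted direction `m_n = (1/n)(e - Φ_n(e·ν) ν)`. -/
def refracted (n : ℝ) (e ν : E3) : E3 := (1 / n) • (e - Phi n ⟪e, ν⟫ • ν)

/-- Closed form of the travel distance in terms of the cosine `⟪e, ν⟫`. -/
theorem travel_distance_eq {n : ℝ} (hn : 1 < n) (d₀ : ℝ) {e ν : E3} (he : ‖e‖ = 1) :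
    (n - 1) * d₀ / (n - ⟪refracted n e ν, e⟫) =
      d₀ * (n / (n + 1) * (1 + ⟪e, ν⟫ / √(n ^ 2 - 1 + ⟪e, ν⟫ ^ 2))) := by
  have hin : ⟪refracted n e ν, e⟫ = 1 / n * (1 - Phi n ⟪e, ν⟫ * ⟪e, ν⟫) := by
    rw [refracted, real_inner_smul_left, inner_sub_left, real_inner_smul_left,
      real_inner_self_eq_norm_sq, he, real_inner_comm e ν, one_pow]
  rw [hin, Phi]
  generalize ⟪e, ν⟫ = s
  have hpos : 0 < n ^ 2 - 1 + s ^ 2 := by nlinarith [sq_nonneg s]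
  have ht := Real.sqrt_pos.2 hpos
  have hsq := Real.sq_sqrt hpos.le
  set t := √(n ^ 2 - 1 + s ^ 2)
  have hts : 0 < t - s := by nlinarith
  have hn0 : 0 < n := by linarith
  have hden : n - 1 / n * (1 - (s - t) * s) = t * (t - s) / n := by
    field_simp
    linarith
  rw [hden]
  field_simp
  linear_combination (-d₀) * hsq

/-- The ratio `s / √(κ² - 1 + s²)` is bounded by `1` in absolute value. -/
theorem abs_div_sqrt_le_one {κ : ℝ} (hκ : 1 < κ) (s : ℝ) :
    |s / √(κ ^ 2 - 1 + s ^ 2)| ≤ 1 := by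
  rw [abs_div, abs_of_nonneg (Real.sqrt_nonneg _)]
  refine div_le_one_of_le₀ (Real.abs_le_sqrt ?_) (Real.sqrt_nonneg _)
  nlinarith

/-- Lipschitz estimate in `κ` for `s / √(κ² - 1 + s²)`, uniform in `s`. -/
theorem abs_div_sqrt_sub_le {a b : ℝ} (ha : 1 < a) (hab : a < b) (s : ℝ) :
    |s / √(a ^ 2 - 1 + s ^ 2) - s / √(b ^ 2 - 1 + s ^ 2)| ≤
      (a + b) / (b ^ 2 - 1) * (b - a) := by
  have hb : 0 < b ^ 2 - 1 := by nlinarith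
  have hpa : 0 < a ^ 2 - 1 + s ^ 2 := by nlinarith [sq_nonneg s]
  have hpb : 0 < b ^ 2 - 1 + s ^ 2 := by nlinarith [sq_nonneg s]
  have hs := abs_div_sqrt_le_one ha s
  have hta := Real.sqrt_pos.2 hpa
  have htb := Real.sqrt_pos.2 hpb
  have hsa := Real.sq_sqrt hpa.le
  have hsb := Real.sq_sqrt hpb.le
  set u := √(a ^ 2 - 1 + s ^ 2)
  set v := √(b ^ 2 - 1 + s ^ 2)
  have key : s / u - s / v = s / u * ((b ^ 2 - a ^ 2) / (v * (u + v))) := by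
    have h : b ^ 2 - a ^ 2 = (v - u) * (u + v) := by linarith
    rw [h]
    field_simp
  have hnn : 0 ≤ b ^ 2 - a ^ 2 := by nlinarith
  have hq : 0 ≤ (b ^ 2 - a ^ 2) / (v * (u + v)) := by positivity
  calc |s / u - s / v| = |s / u| * ((b ^ 2 - a ^ 2) / (v * (u + v))) := by
        rw [key, abs_mul, abs_of_nonneg hq]
    _ ≤ (b ^ 2 - a ^ 2) / (v * (u + v)) := mul_le_of_le_one_left hq hs
    _ ≤ (b ^ 2 - a ^ 2) / (b ^ 2 - 1) := by
        refine div_le_div_of_nonneg_left hnn hb ?_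
        nlinarith [mul_pos hta htb, sq_nonneg s]
    _ = (a + b) / (b ^ 2 - 1) * (b - a) := by ring

theorem travel_distance_difference_estimate
    (n_r n_b d₀ : ℝ) (hr : 1 < n_r) (hrb : n_r < n_b) (hd₀ : 0 < d₀) :
    ∃ C' : ℝ, ∀ e ν : E3, ‖e‖ = 1 → ‖ν‖ = 1 →
      |(n_r - 1) * d₀ / (n_r - ⟪refracted n_r e ν, e⟫) -
          (n_b - 1) * d₀ / (n_b - ⟪refracted n_b e ν, e⟫)| ≤ C' * |n_r - n_b| := by
  refine ⟨d₀ * (1 / 2 + (n_r + n_b) / (n_b ^ 2 - 1)), fun e ν he _ => ?_⟩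
  rw [travel_distance_eq hr d₀ he, travel_distance_eq (hr.trans hrb) d₀ he]
  generalize ⟪e, ν⟫ = s
  have hx := abs_div_sqrt_le_one hr s
  have hxy := abs_div_sqrt_sub_le hr hrb s
  set x := s / √(n_r ^ 2 - 1 + s ^ 2)
  set y := s / √(n_b ^ 2 - 1 + s ^ 2)
  have hb0 : 0 < n_b := by linarith
  have hq : |n_r / (n_r + 1) - n_b / (n_b + 1)| ≤ (n_b - n_r) / 4 := by
    have h : n_r / (n_r + 1) - n_b / (n_b + 1) = -((n_b - n_r) / ((n_r + 1) * (n_b + 1))) := by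
      have h₁ : n_r + 1 ≠ 0 := by linarith
      have h₂ : n_b + 1 ≠ 0 := by linarith
      field_simp
      ring
    have hnn : 0 ≤ n_b - n_r := by linarith
    rw [h, abs_neg, abs_of_nonneg (div_nonneg hnn (by nlinarith))]
    exact div_le_div_of_nonneg_left hnn (by norm_num) (by nlinarith)
  have hx2 : |1 + x| ≤ 2 := by
    rw [abs_le] at hx ⊢
    constructor <;> linarith
  have hq1 : |n_b / (n_b + 1)| ≤ 1 := by
    rw [abs_of_pos (by positivity)]
    exact div_le_one_of_le₀ (by linarith) (by linarith)
  have hsplit : d₀ * (n_r / (n_r + 1) * (1 + x)) - d₀ * (n_b / (n_b + 1) * (1 + y)) =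
      d₀ * ((n_r / (n_r + 1) - n_b / (n_b + 1)) * (1 + x) + n_b / (n_b + 1) * (x - y)) := by
    ring
  rw [hsplit, abs_mul, abs_of_pos hd₀, mul_assoc, abs_sub_comm n_r,
    abs_of_pos (sub_pos.2 hrb)]
  refine mul_le_mul_of_nonneg_left ?_ hd₀.le
  calc _ ≤ |n_r / (n_r + 1) - n_b / (n_b + 1)| * |1 + x| + |n_b / (n_b + 1)| * |x - y| := by
        rw [← abs_mul, ← abs_mul]
        exact abs_add_le _ _
    _ ≤ (n_b - n_r) / 4 * 2 + 1 * ((n_r + n_b) / (n_b ^ 2 - 1) * (n_b - n_r)) := by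
        gcongr
    _ = (1 / 2 + (n_r + n_b) / (n_b ^ 2 - 1)) * (n_b - n_r) := by ring
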